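/- Let k ≥ 2 be an integer and p = (p_1,…,p_k) a tuple of non-negative integers such that M_{p,k−1} is non-empty. Let S = (S_1,…,S_{k−1}) be a uniformly random element of M_{p,k−1}, and let G_α(S) be the digraph on vertex set [k] with arcs (i, α(i,S_i)) for i∈[k−1]. Then the probability that G_α(S) is a tree equals 1 − p_k/(k−1). -/

import Mathlib

open Finset

/-- The cyclic interval `]i,j]` of `[k] = {1,…,k}`, realized inside `ZMod k`
(the element `k` of `[k]` is represented by `0 : ZMod k`). -/
def cyc (k : ℕ) [NeZero k] (i j : ZMod k) : Finset (ZMod k) :=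
  Finset.univ.filter fun x => 1 ≤ (x - i).val ∧ (x - i).val ≤ (j - i).val

/-- Membership in `𝒮_{p,r}` : each `j ∈ [k]` belongs to exactly `p j` of the sets `S_1,…,S_r`. -/
def SprMem (k r : ℕ) [NeZero k] (p : ZMod k → ℕ) (S : Fin r → Finset (ZMod k)) : Prop :=
  ∀ j : ZMod k, Nat.card {i : Fin r // j ∈ S i} = p j

/-- Membership in `ℳ_{p,r}` : member of `𝒮_{p,r}` all of whose sets are proper subsets of `[k]`. -/
def MprMem (k r : ℕ) [NeZero k] (p : ZMod k → ℕ) (S : Fin r → Finset (ZMod k)) : Prop :=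
  SprMem k r p S ∧ ∀ i, S i ≠ Finset.univ

/-- `|ℳ_{p,r}|`. -/
noncomputable def Mcard (k r : ℕ) [NeZero k] (p : ZMod k → ℕ) : ℕ :=
  Nat.card {S : Fin r → Finset (ZMod k) // MprMem k r p S}

/-- `|𝒮_{p,r}|`. -/
noncomputable def Scard (k r : ℕ) [NeZero k] (p : ZMod k → ℕ) : ℕ :=
  Nat.card {S : Fin r → Finset (ZMod k) // SprMem k r p S}

/-- `|ℳ_{q,r}|` for an integer-valued tuple `q` (empty if some entry of `q` is negative). -/
noncomputable def McardZ (k r : ℕ) [NeZero k] (q : ZMod k → ℤ) : ℕ :=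
  Nat.card {S : Fin r → Finset (ZMod k) //
    (∀ j : ZMod k, (Nat.card {i : Fin r // j ∈ S i} : ℤ) = q j) ∧ ∀ i, S i ≠ Finset.univ}

/-- `alphaRel k S i j` holds iff `j = α(i,S)`. -/
def alphaRel (k : ℕ) [NeZero k] (S : Finset (ZMod k)) (i j : ZMod k) : Prop :=
  if S = Finset.univ then j = i else j ∉ S ∧ cyc k i (j - 1) ⊆ S

/-- `betaRel k S i j` holds iff `j = β(i,S)`. -/
def betaRel (k : ℕ) [NeZero k] (S : Finset (ZMod k)) (i j : ZMod k) : Prop :=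
  if S = Finset.univ then j = i else j + 1 ∉ S ∧ cyc k i j ⊆ S

/-- `gammaRel k S i j` holds iff `j = γ(i,S)`. -/
def gammaRel (k : ℕ) [NeZero k] (S : Finset (ZMod k)) (i j : ZMod k) : Prop :=
  if S = Finset.univ then j = i
  else if i ∈ S then j = i - 1
  else j + 1 ∉ S ∧ cyc k i j ⊆ S

/-- The digraph on `[k]` with the `k-1` arcs `(i, ζ(i, S_{f i}))` for `i ∈ [k-1]`
(the nonzero elements of `ZMod k`) is a tree, i.e. a spanning tree oriented toward
the root `k` (represented by `0`): following the arcs from any vertex reaches the root. -/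
def GIsTree (k r : ℕ) [NeZero k] (zeta : Finset (ZMod k) → ZMod k → ZMod k → Prop)
    (S : Fin r → Finset (ZMod k)) (f : {i : ZMod k // i ≠ 0} → Fin r) : Prop :=
  ∃ g : ZMod k → ZMod k, g 0 = 0 ∧
    (∀ i : {i : ZMod k // i ≠ 0}, zeta (S (f i)) i.1 (g i.1)) ∧
    ∀ x : ZMod k, ∃ n : ℕ, g^[n] x = 0

/-- Sample space: pairs of a tuple `S ∈ ℳ_{p,r}` and a surjection `f : [k-1] → [r]`,
with the uniform probability measure. -/
abbrev OmM (k r : ℕ) [NeZero k] (p : ZMod k → ℕ) : Type :=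
  {om : (Fin r → Finset (ZMod k)) × ({i : ZMod k // i ≠ 0} → Fin r) //
    MprMem k r p om.1 ∧ Function.Surjective om.2}

/-- Sample space `Ω`: pairs of a tuple `S ∈ 𝒮_{p,r}` and a surjection `f : [k-1] → [r]`,
with the uniform probability measure. -/
abbrev OmS (k r : ℕ) [NeZero k] (p : ZMod k → ℕ) : Type :=
  {om : (Fin r → Finset (ZMod k)) × ({i : ZMod k // i ≠ 0} → Fin r) //
    SprMem k r p om.1 ∧ Function.Surjective om.2}

/-- Uniform probability of an event `A` in a (finite) sample space `Om`. -/
noncomputable def PrU {Om : Type} (A : Set Om) : ℚ :=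
  (Nat.card A : ℚ) / (Nat.card Om : ℚ)

/-- The `Pr`-determinant of a `k × k` matrix of events (rows and columns indexed by
`[k]`, i.e. by `ZMod k`). -/
noncomputable def Pdet {k : ℕ} [NeZero k] {Om : Type} (E : ZMod k → ZMod k → Set Om) : ℚ :=
  ∑ pi : Equiv.Perm (ZMod k), ((Equiv.Perm.sign pi : ℤ) : ℚ) * PrU (⋂ i : ZMod k, E i (pi i))

/-- The matrix of events `M_α`: `M_{α,i,j} = I^{f(i)}_{i,j}` for `i ∈ [k-1]`, and the
row of `i = k` (i.e. `0`) is constant equal to `Ω`. -/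
def Malpha (k r : ℕ) [NeZero k] (p : ZMod k → ℕ) (i j : ZMod k) : Set (OmS k r p) :=
  {om : OmS k r p | ∀ hi : i ≠ 0, cyc k i j ⊆ om.1.1 (om.1.2 ⟨i, hi⟩)}

/-- The matrix of events `M_β`: `M_{β,i,j} = J^{f(i)}_{i,j+1}` for `i ∈ [k-1]`, and the
row of `i = k` (i.e. `0`) is constant equal to `Ω`. -/
def Mbeta (k r : ℕ) [NeZero k] (p : ZMod k → ℕ) (i j : ZMod k) : Set (OmS k r p) :=
  {om : OmS k r p | ∀ hi : i ≠ 0,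
    if i = j + 1 then om.1.1 (om.1.2 ⟨i, hi⟩) = Finset.univ
    else cyc k i (j + 1) ⊆ om.1.1 (om.1.2 ⟨i, hi⟩)}

/-- Membership of `om` in the event `J^{f(i)}_{a,b}`. -/
def Jmem (k r : ℕ) [NeZero k] (p : ZMod k → ℕ) (om : OmS k r p)
    (i : {i : ZMod k // i ≠ 0}) (a b : ZMod k) : Prop :=
  if a = b then om.1.1 (om.1.2 i) = Finset.univ else cyc k a b ⊆ om.1.1 (om.1.2 i)

/-! ### Two determinant evaluations -/

/-- A matrix that is strictly triangular off the diagonal for a (not necessarily injective)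
ranking of the indices has the product of its diagonal as determinant. -/
lemma det_eq_prod_diag_of_rank {ι R : Type*} [Fintype ι] [DecidableEq ι] [CommRing R]
    (f : ι → ℤ) (M : Matrix ι ι R) (h : ∀ i j, i ≠ j → f j ≤ f i → M i j = 0) :
    M.det = ∏ i, M i i := by
  rw [Matrix.det_apply']
  rw [Finset.sum_eq_single 1]
  · simp
  · intro s _ hs
    have hne : s.support.Nonempty := by
      rw [Finset.nonempty_iff_ne_empty]
      simpa [Equiv.Perm.support_eq_empty_iff] using hs
    obtain ⟨i, hi, hmin⟩ := s.support.exists_min_image f hne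
    have hz : M (s i) i = 0 :=
      h _ _ (Equiv.Perm.mem_support.1 hi) (hmin _ (Equiv.Perm.apply_mem_support.2 hi))
    exact mul_eq_zero_of_right _ (Finset.prod_eq_zero (Finset.mem_univ i) hz)
  · simp

/-- The reduced Laplacian determinant of a functional digraph rooted at `0` is the indicator of
being a tree. -/
lemma det_functional_laplacian {V R : Type*} [Fintype V] [DecidableEq V] [Zero V]
    [CommRing R] [IsDomain R] (g : V → V) (h0 : g 0 = 0)
    [Decidable (∀ x, ∃ n : ℕ, g^[n] x = 0)] :
    (Matrix.of fun i j : {i : V // i ≠ 0} =>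
      (if i.1 = j.1 then (1 : R) else 0) - if g i.1 = j.1 then 1 else 0).det =
      if ∀ x, ∃ n : ℕ, g^[n] x = 0 then 1 else 0 := by
  classical
  split_ifs with h
  · have hstep : ∀ x : V, x ≠ 0 → Nat.find (h (g x)) < Nat.find (h x) := by
      intro x hx
      have hs := Nat.find_spec (h x)
      cases hn : Nat.find (h x) with
      | zero => rw [hn] at hs; exact absurd hs hx
      | succ n =>
        rw [hn, Function.iterate_succ_apply] at hs
        exact Nat.lt_succ_of_le (Nat.find_min' _ hs)
    have hg : ∀ i : {i : V // i ≠ 0}, g i.1 ≠ i.1 := by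
      intro i hi
      have := hstep i.1 i.2
      simp only [hi, lt_irrefl] at this
    rw [det_eq_prod_diag_of_rank (fun i => -((Nat.find (h i.1) : ℕ) : ℤ))]
    · exact Finset.prod_eq_one fun i _ => by simp [hg i]
    · intro i j hij hle
      have hgj : g i.1 ≠ j.1 := by
        intro hgj
        have := hstep i.1 i.2
        simp only [hgj] at this
        omega
      simp [Subtype.coe_inj, hij, hgj]
  · push Not at h
    obtain ⟨x, hx⟩ := h
    rw [← Matrix.exists_mulVec_eq_zero_iff]
    refine ⟨fun i => if ∃ n : ℕ, g^[n] i.1 = 0 then 0 else 1, ?_, ?_⟩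
    · intro hv
      have := congrFun hv ⟨x, hx 0⟩
      simp [hx] at this
    · funext i
      have hit : (∃ n : ℕ, g^[n] i.1 = 0) ↔ ∃ n : ℕ, g^[n] (g i.1) = 0 := by
        constructor
        · rintro ⟨n, hn⟩
          exact ⟨n, by rw [← Function.iterate_succ_apply, Function.iterate_succ_apply', hn, h0]⟩
        · rintro ⟨n, hn⟩
          exact ⟨n + 1, hn⟩
      simp only [Matrix.mulVec, dotProduct, Matrix.of_apply, Subtype.coe_inj, sub_mul, ite_mul,
        one_mul, zero_mul, Finset.sum_sub_distrib, Finset.sum_ite_eq, Finset.mem_univ, if_true,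
        Pi.zero_apply]
      by_cases hgi : g i.1 = 0
      · rw [if_pos ⟨1, hgi⟩, zero_sub, neg_eq_zero]
        exact Finset.sum_eq_zero fun j _ => if_neg fun hj => j.2 (hj.symm.trans hgi)
      · rw [Finset.sum_eq_single ⟨g i.1, hgi⟩]
        · simp only [if_true, hit, sub_self]
        · intro j _ hj
          exact if_neg fun hj' => hj (Subtype.ext hj'.symm)
        · simp

/-! ### Cyclic intervals -/

section Cyc

variable {k : ℕ} [NeZero k]

lemma ZMod.val_sub_one_of_ne_zero {y : ZMod k} (hy : y ≠ 0) : (y - 1).val = y.val - 1 := by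
  obtain ⟨n, rfl⟩ := Nat.exists_eq_succ_of_ne_zero (NeZero.ne k)
  exact Fin.val_sub_one_of_ne_zero hy

lemma ZMod.val_neg_one_eq : (-1 : ZMod k).val = k - 1 := by
  obtain ⟨n, rfl⟩ := Nat.exists_eq_succ_of_ne_zero (NeZero.ne k)
  simp [ZMod.val_neg_one]

lemma mem_cyc {i j x : ZMod k} :
    x ∈ cyc k i j ↔ 1 ≤ (x - i).val ∧ (x - i).val ≤ (j - i).val := by
  simp [cyc]

lemma cyc_self (i : ZMod k) : cyc k i i = ∅ := by
  ext x
  simp only [mem_cyc, sub_self, ZMod.val_zero, Finset.notMem_empty, iff_false]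
  omega

lemma mem_cyc_sub_one {i x : ZMod k} : x ∈ cyc k i (i - 1) ↔ x ≠ i := by
  have h := (x - i).val_lt
  rw [mem_cyc, show i - 1 - i = -1 by ring, ZMod.val_neg_one_eq, ← sub_ne_zero (a := x),
    ← ZMod.val_ne_zero]
  omega

lemma cyc_eq_insert_right {i j : ZMod k} (hj : j ≠ i) :
    cyc k i j = insert j (cyc k i (j - 1)) := by
  have h0 := (ZMod.val_ne_zero _).2 (sub_ne_zero.2 hj)
  ext x
  rw [Finset.mem_insert, mem_cyc, mem_cyc, show j - 1 - i = j - i - 1 by ring,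
    ZMod.val_sub_one_of_ne_zero (sub_ne_zero.2 hj)]
  have hx : x = j ↔ (x - i).val = (j - i).val := by
    rw [(ZMod.val_injective k).eq_iff, sub_left_inj]
  rw [hx]
  omega

lemma notMem_cyc_left (i j : ZMod k) : i ∉ cyc k i j := by
  simp [mem_cyc]

lemma cyc_eq_insert_left {i j : ZMod k} (hj : j ≠ i) :
    cyc k i j = insert (i + 1) (cyc k (i + 1) j) := by
  have h0 := (ZMod.val_ne_zero _).2 (sub_ne_zero.2 hj)
  have hlt := (j - i).val_lt
  have h1 : (1 : ZMod k).val = 1 := by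
    rw [ZMod.val_one_eq_one_mod, Nat.mod_eq_of_lt]
    omega
  ext x
  rw [Finset.mem_insert, mem_cyc, mem_cyc, show j - (i + 1) = j - i - 1 by ring,
    ZMod.val_sub_one_of_ne_zero (sub_ne_zero.2 hj)]
  have hx : x = i + 1 ↔ (x - i).val = 1 := by
    rw [← sub_eq_iff_eq_add', ← (ZMod.val_injective k).eq_iff, h1]
  rw [hx, show x - (i + 1) = x - i - 1 by ring]
  by_cases hxi : x - i = 0
  · have hlt' := (-1 : ZMod k).val_lt
    rw [hxi, zero_sub, ZMod.val_neg_one_eq, ZMod.val_zero]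
    omega
  · rw [ZMod.val_sub_one_of_ne_zero hxi]
    have := (ZMod.val_ne_zero _).2 hxi
    omega

lemma insert_cyc_add_one (i : ZMod k) : insert (i + 1) (cyc k (i + 1) i) = Finset.univ := by
  ext x
  have := mem_cyc_sub_one (i := i + 1) (x := x)
  rw [add_sub_cancel_right] at this
  simp only [Finset.mem_insert, this, Finset.mem_univ, iff_true]
  exact em _

open Classical in
/-- The arc indicators of `α` telescope in terms of the events `]i,j] ⊆ A`. -/
lemma alphaRel_telescope {R : Type*} [Ring R] {A : Finset (ZMod k)} (hA : A ≠ Finset.univ)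
    (i j : ZMod k) :
    (if i = j then (1 : R) else 0) - (if alphaRel k A i j then 1 else 0) =
      (if cyc k i j ⊆ A then 1 else 0) - if cyc k i (j - 1) ⊆ A then 1 else 0 := by
  simp only [alphaRel, if_neg hA]
  by_cases hij : i = j
  · subst hij
    have himp : cyc k i (i - 1) ⊆ A → i ∉ A := fun hs hi => hA <| by
      ext x
      by_cases hx : x = i
      · simp [hx, hi]
      · simpa using hs (mem_cyc_sub_one.2 hx)
    have : (i ∉ A ∧ cyc k i (i - 1) ⊆ A) ↔ cyc k i (i - 1) ⊆ A :=
      ⟨And.right, fun h => ⟨himp h, h⟩⟩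
    simp [cyc_self, this]
  · simp only [cyc_eq_insert_right (Ne.symm hij), Finset.insert_subset_iff]
    by_cases h1 : j ∈ A <;> by_cases h2 : cyc k i (j - 1) ⊆ A <;> simp [hij, h1, h2]

lemma existsUnique_alphaRel {A : Finset (ZMod k)} (hA : A ≠ Finset.univ) (i : ZMod k) :
    ∃! j, alphaRel k A i j := by
  classical
  have h := Finset.sum_congr rfl fun j (_ : j ∈ (Finset.univ : Finset (ZMod k))) =>
    alphaRel_telescope (R := ℤ) hA i j
  have hshift : ∑ j : ZMod k, (if cyc k i (j - 1) ⊆ A then (1 : ℤ) else 0) =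
      ∑ j : ZMod k, if cyc k i j ⊆ A then (1 : ℤ) else 0 :=
    Fintype.sum_equiv (Equiv.subRight 1) _ _ fun _ => rfl
  rw [Finset.sum_sub_distrib, Finset.sum_sub_distrib, hshift, sub_self, Finset.sum_ite_eq,
    if_pos (Finset.mem_univ _), ← Finset.natCast_card_filter] at h
  have hcard : (Finset.univ.filter fun j => alphaRel k A i j).card = 1 := by omega
  obtain ⟨j, hj⟩ := Finset.card_eq_one.1 hcard
  refine ⟨j, ?_, fun y hy => ?_⟩
  · have : j ∈ Finset.univ.filter fun j => alphaRel k A i j := by simp [hj]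
    simpa using this
  · have : y ∈ Finset.univ.filter fun j => alphaRel k A i j := by simpa using hy
    simpa [hj] using this

end Cyc

/-! ### The weighted Laplacian -/

section Weighted

variable {V R : Type*} [Fintype V] [DecidableEq V] [CommRing R]

/-- The generating function `∑_{A ⊇ B} ∏_{l ∈ A} x_l` of the supersets of `B`, in product form. -/
def supersetGF (x : V → R) (B : Finset V) : R :=
  ∏ l, (x l + if l ∈ B then 0 else 1)

lemma supersetGF_eq_sum (x : V → R) (B : Finset V) :
    supersetGF x B = ∑ A : Finset V, (if B ⊆ A then 1 else 0) * ∏ l ∈ A, x l := by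
  rw [supersetGF, Finset.prod_add, Finset.powerset_univ]
  refine Finset.sum_congr rfl fun A _ => ?_
  rw [mul_comm]
  congr 1
  split_ifs with h
  · exact Finset.prod_eq_one fun l hl =>
      if_neg fun hB => (Finset.mem_sdiff.1 hl).2 (h hB)
  · obtain ⟨l, hB, hA⟩ := Finset.not_subset.1 h
    exact Finset.prod_eq_zero (i := l) (by simpa using hA) (by simp [hB])

lemma one_add_mul_supersetGF_insert (x : V → R) {m : V} {B : Finset V} (hm : m ∉ B) :
    (1 + x m) * supersetGF x (insert m B) = x m * supersetGF x B := by
  rw [supersetGF, supersetGF, ← Finset.mul_prod_erase _ _ (Finset.mem_univ m),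
    ← Finset.mul_prod_erase _ _ (Finset.mem_univ m)]
  have : ∏ l ∈ Finset.univ.erase m, (x l + if l ∈ insert m B then 0 else 1) =
      ∏ l ∈ Finset.univ.erase m, (x l + if l ∈ B then 0 else 1) :=
    Finset.prod_congr rfl fun l hl => by simp [Finset.ne_of_mem_erase hl]
  rw [this]
  simp only [Finset.mem_insert_self, if_true, hm, if_false]
  ring

variable {k : ℕ} [NeZero k]

lemma supersetGF_cyc_recurrence (x : ZMod k → R) (i j : ZMod k) :
    (1 + x (i + 1)) * supersetGF x (cyc k i j) - x (i + 1) * supersetGF x (cyc k (i + 1) j) =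
      if i = j then (1 + x (i + 1)) * (supersetGF x ∅ - supersetGF x Finset.univ) else 0 := by
  rw [← one_add_mul_supersetGF_insert x (notMem_cyc_left (i + 1) j)]
  split_ifs with h
  · subst h
    rw [insert_cyc_add_one, cyc_self]
    ring
  · rw [cyc_eq_insert_left (Ne.symm h), sub_self]

lemma det_weighted_laplacian [IsDomain R] (x : ZMod k → R) (hx : ∀ l, 1 + x l ≠ 0)
    (hk : (-1 : ZMod k) ≠ 0) :
    (Matrix.of fun i j : {i : ZMod k // i ≠ 0} =>
      supersetGF x (cyc k i.1 j.1) - supersetGF x (cyc k i.1 (j.1 - 1))).det =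
    ∏ i : {i : ZMod k // i ≠ 0}, if i = ⟨-1, hk⟩ then supersetGF x ∅ - supersetGF x {0}
      else supersetGF x ∅ - supersetGF x Finset.univ := by
  set L' : Matrix {i : ZMod k // i ≠ 0} {i : ZMod k // i ≠ 0} R := Matrix.of fun i j =>
    supersetGF x (cyc k i.1 j.1) - supersetGF x (cyc k i.1 0) with hL'
  set D : Matrix {i : ZMod k // i ≠ 0} {i : ZMod k // i ≠ 0} R := Matrix.of fun i j =>
    (if i = j then 1 else 0) - if i.1 = j.1 - 1 then 1 else 0 with hD
  set E : Matrix {i : ZMod k // i ≠ 0} {i : ZMod k // i ≠ 0} R := Matrix.of fun i j =>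
    (if i = j then 1 + x (i.1 + 1) else 0) - if i.1 + 1 = j.1 then x (i.1 + 1) else 0 with hE
  have h01 : (0 : ZMod k) ≠ 1 := fun h => hk (by rw [← h, neg_zero])
  have hLD : (Matrix.of fun i j : {i : ZMod k // i ≠ 0} =>
      supersetGF x (cyc k i.1 j.1) - supersetGF x (cyc k i.1 (j.1 - 1))) = L' * D := by
    ext i j
    simp only [hL', hD, Matrix.mul_apply, Matrix.of_apply, mul_sub, mul_ite, mul_one, mul_zero,
      Finset.sum_sub_distrib, Finset.sum_ite_eq', Finset.mem_univ, if_true]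
    by_cases hj : j.1 - 1 = 0
    · rw [Finset.sum_eq_zero fun m _ => if_neg fun hm => m.2 (hm.trans hj), hj, sub_zero]
    · rw [Finset.sum_eq_single ⟨j.1 - 1, hj⟩]
      · simp
      · exact fun m _ hm => if_neg fun hm' => hm (Subtype.ext hm')
      · simp
  have hdetD : D.det = 1 := by
    rw [det_eq_prod_diag_of_rank (fun i => (i.1.val : ℤ))]
    · exact Finset.prod_eq_one fun i _ => by simp [hD, eq_sub_iff_add_eq, Ne.symm h01]
    · intro i j hij hle
      have : i.1 ≠ j.1 - 1 := fun h => by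
        have h1 := ZMod.val_sub_one_of_ne_zero j.2
        have h2 := (ZMod.val_ne_zero _).2 j.2
        rw [← h] at h1
        omega
      simp [hD, hij, this]
  have hdetE : E.det = ∏ i : {i : ZMod k // i ≠ 0}, (1 + x (i.1 + 1)) := by
    rw [det_eq_prod_diag_of_rank (fun i => (i.1.val : ℤ))]
    · exact Finset.prod_congr rfl fun i _ => by simp [hE, Ne.symm h01]
    · intro i j hij hle
      have : i.1 + 1 ≠ j.1 := fun h => by
        have h1 := ZMod.val_sub_one_of_ne_zero j.2
        have h2 := (ZMod.val_ne_zero _).2 j.2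
        rw [← h, add_sub_cancel_right, h] at h1
        omega
      simp [hE, hij, this]
  have hEL : ∀ i j, (E * L') i j = if i.1 + 1 = 0 then (1 + x 0) * L' i j else
      if i = j then (1 + x (i.1 + 1)) * (supersetGF x ∅ - supersetGF x Finset.univ) else 0 := by
    intro i j
    simp only [hE, Matrix.mul_apply, Matrix.of_apply, sub_mul, ite_mul, zero_mul,
      Finset.sum_sub_distrib, Finset.sum_ite_eq, Finset.mem_univ, if_true]
    split_ifs with hi hij
    · rw [Finset.sum_eq_zero fun m _ => if_neg fun hm => m.2 (hm.symm.trans hi), hi, sub_zero]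
    all_goals
      rw [Finset.sum_eq_single ⟨i.1 + 1, hi⟩
        (fun m _ hm => if_neg fun hm' => hm (Subtype.ext hm'.symm)) (by simp), if_pos rfl]
      have h1 := supersetGF_cyc_recurrence x i.1 j.1
      have h2 := supersetGF_cyc_recurrence x i.1 0
      rw [if_neg i.2] at h2
      simp only [← Subtype.ext_iff] at h1
      first | rw [if_pos hij] at h1 | rw [if_neg hij] at h1
      simp only [hL', Matrix.of_apply]
      linear_combination h1 - h2
  have hdetEL : (E * L').det = ∏ i : {i : ZMod k // i ≠ 0}, (1 + x (i.1 + 1)) *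
      if i = ⟨-1, hk⟩ then supersetGF x ∅ - supersetGF x {0}
      else supersetGF x ∅ - supersetGF x Finset.univ := by
    rw [det_eq_prod_diag_of_rank (fun i => -(i.1.val : ℤ))]
    · refine Finset.prod_congr rfl fun i _ => ?_
      rw [hEL]
      by_cases hi : i.1 = -1
      · have : cyc k (-1) 0 = {0} := by
          rw [cyc_eq_insert_left hk.symm, neg_add_cancel, cyc_self, insert_empty_eq]
        rw [if_pos (by rw [hi, neg_add_cancel]), if_pos (Subtype.ext hi)]
        simp [hL', hi, this, cyc_self]
      · rw [if_neg (fun h => hi (eq_neg_of_add_eq_zero_left h)), if_pos rfl,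
          if_neg (fun h => hi (congrArg Subtype.val h))]
    · intro i j hij hle
      have : i.1 + 1 ≠ 0 := fun h => by
        have h1 := congrArg ZMod.val (eq_neg_of_add_eq_zero_left h)
        rw [ZMod.val_neg_one_eq] at h1
        have h2 := j.1.val_lt
        exact hij (Subtype.ext (ZMod.val_injective k (by omega)))
      rw [hEL, if_neg this, if_neg hij]
  rw [Matrix.det_mul, hdetE, Finset.prod_mul_distrib] at hdetEL
  rw [hLD, Matrix.det_mul, hdetD, mul_one]
  exact mul_left_cancel₀ (Finset.prod_ne_zero_iff.2 fun i _ => hx _) hdetEL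

end Weighted

/-! ### Passing to generating functions of tuples -/

section Tuples

variable {ι V R : Type*} [Fintype ι] [Fintype V] [CommRing R]

lemma det_sum_rows [DecidableEq ι] (w : Finset V → R) (c : Finset V → ι → ι → R) :
    (Matrix.of fun i j => ∑ A, w A * c A i j).det =
      ∑ S : ι → Finset V, (∏ i, w (S i)) * (Matrix.of fun i j => c (S i) i j).det := by
  have h := (Matrix.detRowAlternating (R := R) (n := ι)).toMultilinearMap.map_sum
    (fun i (A : Finset V) => fun j => w A * c A i j)
  have h' : (Matrix.of fun i j => ∑ A, w A * c A i j) =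
      fun i => ∑ A, fun j => w A * c A i j := by
    ext i j
    simp
  rw [h']
  refine h.trans (Finset.sum_congr rfl fun S _ => ?_)
  exact Matrix.det_mul_column (fun i => w (S i)) (Matrix.of fun i j => c (S i) i j)


variable [DecidableEq V]

lemma coeff_prod_tuple (p : V → ℕ) (S : ι → Finset V)
    [Decidable (∀ j, Nat.card {i // j ∈ S i} = p j)] :
    MvPolynomial.coeff (Finsupp.equivFunOnFinite.symm p)
      (∏ i, ∏ l ∈ S i, (MvPolynomial.X l : MvPolynomial V ℤ)) =
      if ∀ j, Nat.card {i // j ∈ S i} = p j then 1 else 0 := by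
  have h : ∏ i, ∏ l ∈ S i, (MvPolynomial.X l : MvPolynomial V ℤ) =
      MvPolynomial.monomial (Finsupp.equivFunOnFinite.symm fun j => Nat.card {i // j ∈ S i}) 1 := by
    have h1 : ∀ i, ∏ l ∈ S i, (MvPolynomial.X l : MvPolynomial V ℤ) =
        ∏ l, if l ∈ S i then MvPolynomial.X l else 1 := fun i => by simp
    rw [Finset.prod_congr rfl fun i _ => h1 i, Finset.prod_comm, MvPolynomial.monomial_eq,
      Finsupp.prod_fintype _ _ (by simp)]
    simp only [map_one, one_mul, Finsupp.equivFunOnFinite_symm_apply_apply]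
    refine Finset.prod_congr rfl fun l _ => ?_
    rw [Finset.prod_ite, Finset.prod_const, Finset.prod_const_one, mul_one,
      Nat.card_eq_fintype_card, Fintype.card_subtype]
  rw [h, MvPolynomial.coeff_monomial]
  simp only [EmbeddingLike.apply_eq_iff_eq, funext_iff]

lemma coeff_sum_tuples [DecidableEq ι] (p : V → ℕ) (Q : (ι → Finset V) → Prop)
    [DecidablePred Q] :
    MvPolynomial.coeff (Finsupp.equivFunOnFinite.symm p)
      (∑ S : ι → Finset V, (if Q S then 1 else 0) *
        ∏ i, ∏ l ∈ S i, (MvPolynomial.X l : MvPolynomial V ℤ)) =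
      (Nat.card {S : ι → Finset V // (∀ j, Nat.card {i // j ∈ S i} = p j) ∧ Q S} : ℤ) := by
  classical
  rw [MvPolynomial.coeff_sum, Nat.card_eq_fintype_card, Fintype.card_subtype,
    Finset.natCast_card_filter]
  refine Finset.sum_congr rfl fun S _ => ?_
  by_cases hQ : Q S
  · rw [if_pos hQ, one_mul, coeff_prod_tuple]
    simp [hQ]
  · simp [hQ]

end Tuples

/-! ### Equidistribution of the tree event -/

section Main

variable {k : ℕ} [NeZero k]

/-- The digraph `G_α(S)` is a tree. -/
def AlphaTree (S : {i : ZMod k // i ≠ 0} → Finset (ZMod k)) : Prop :=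
  ∃ g : ZMod k → ZMod k, g 0 = 0 ∧
    (∀ i : {i : ZMod k // i ≠ 0}, alphaRel k (S i) i.1 (g i.1)) ∧
    ∀ x : ZMod k, ∃ n : ℕ, g^[n] x = 0

open Classical in
lemma det_alpha_laplacian {R : Type*} [CommRing R] [IsDomain R]
    {S : {i : ZMod k // i ≠ 0} → Finset (ZMod k)} (hS : ∀ i, S i ≠ Finset.univ) :
    (Matrix.of fun i j : {i : ZMod k // i ≠ 0} =>
      (if i.1 = j.1 then (1 : R) else 0) - if alphaRel k (S i) i.1 j.1 then 1 else 0).det =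
      if AlphaTree S then 1 else 0 := by
  choose a ha using fun i => existsUnique_alphaRel (hS i) i.1
  set g : ZMod k → ZMod k := fun x => if hx : x ≠ 0 then a ⟨x, hx⟩ else 0 with hg
  have hga : ∀ i : {i : ZMod k // i ≠ 0}, g i.1 = a i := fun i => by simp [hg, i.2]
  have hrel : ∀ (i : {i : ZMod k // i ≠ 0}) (j : ZMod k),
      alphaRel k (S i) i.1 j ↔ g i.1 = j := fun i j => by
    rw [hga]
    exact ⟨fun h => ((ha i).2 j h).symm, fun h => h ▸ (ha i).1⟩
  have hg0 : g 0 = 0 := by simp [hg]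
  have htree : AlphaTree S ↔ ∀ x, ∃ n : ℕ, g^[n] x = 0 := by
    refine ⟨?_, fun h => ⟨g, hg0, fun i => (hrel i _).2 rfl, h⟩⟩
    rintro ⟨g', h0, h1, h2⟩
    have : g' = g := by
      funext x
      by_cases hx : x = 0
      · rw [hx, h0, hg0]
      · exact ((hrel ⟨x, hx⟩ _).1 (h1 ⟨x, hx⟩)).symm
    rwa [← this]
  have hmat : (Matrix.of fun i j : {i : ZMod k // i ≠ 0} =>
      (if i.1 = j.1 then (1 : R) else 0) - if alphaRel k (S i) i.1 j.1 then 1 else 0) =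
      Matrix.of fun i j => (if i.1 = j.1 then (1 : R) else 0) - if g i.1 = j.1 then 1 else 0 := by
    ext i j
    simp [hrel]
  rw [hmat, det_functional_laplacian g hg0]
  simp only [htree]

open Classical in
/-- For tuples of proper subsets, "`G_α(S)` is a tree" and "`0 ∉ S_{i₀}`" have the same generating
function. -/
lemma sum_alphaTree_eq {R : Type*} [CommRing R] [IsDomain R] (x : ZMod k → R)
    (hx : ∀ l, 1 + x l ≠ 0) (hk : (-1 : ZMod k) ≠ 0) (i₀ : {i : ZMod k // i ≠ 0}) :
    ∑ S : {i : ZMod k // i ≠ 0} → Finset (ZMod k),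
      (if (∀ i, S i ≠ Finset.univ) ∧ AlphaTree S then 1 else 0) * ∏ i, ∏ l ∈ S i, x l =
    ∑ S : {i : ZMod k // i ≠ 0} → Finset (ZMod k),
      (if (∀ i, S i ≠ Finset.univ) ∧ 0 ∉ S i₀ then 1 else 0) * ∏ i, ∏ l ∈ S i, x l := by
  set w : Finset (ZMod k) → R := fun A => (if A ≠ Finset.univ then 1 else 0) * ∏ l ∈ A, x l with hw
  have hT : supersetGF x ∅ - supersetGF x Finset.univ = ∑ A, w A := by
    rw [supersetGF_eq_sum, supersetGF_eq_sum, ← Finset.sum_sub_distrib]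
    refine Finset.sum_congr rfl fun A _ => ?_
    by_cases hA : A = Finset.univ <;> simp [hw, hA, Finset.univ_subset_iff]
  have hQ : supersetGF x ∅ - supersetGF x {0} = ∑ A, (if (0 : ZMod k) ∉ A then w A else 0) := by
    rw [supersetGF_eq_sum, supersetGF_eq_sum, ← Finset.sum_sub_distrib]
    refine Finset.sum_congr rfl fun A _ => ?_
    by_cases hA : (0 : ZMod k) ∈ A
    · simp [hA]
    · have : A ≠ Finset.univ := fun h => hA (h ▸ Finset.mem_univ _)
      simp [hw, hA, this]
  have hL : ∀ i j : {i : ZMod k // i ≠ 0},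
      supersetGF x (cyc k i.1 j.1) - supersetGF x (cyc k i.1 (j.1 - 1)) =
      ∑ A, w A * ((if i.1 = j.1 then (1 : R) else 0) - if alphaRel k A i.1 j.1 then 1 else 0) := by
    intro i j
    rw [supersetGF_eq_sum, supersetGF_eq_sum, ← Finset.sum_sub_distrib]
    refine Finset.sum_congr rfl fun A _ => ?_
    by_cases hA : A = Finset.univ
    · simp [hw, hA]
    · rw [alphaRel_telescope hA]
      simp only [hw, ne_eq, hA, not_false_eq_true, if_true]
      ring
  have hwprod : ∀ S : {i : ZMod k // i ≠ 0} → Finset (ZMod k), ∏ i, w (S i) =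
      (if ∀ i, S i ≠ Finset.univ then 1 else 0) * ∏ i, ∏ l ∈ S i, x l := fun S => by
    rw [hw, Finset.prod_mul_distrib, Finset.prod_ite_zero]
    simp
  have hdet := det_weighted_laplacian x hx hk
  simp only [hL] at hdet
  rw [det_sum_rows w fun A (i j : {i : ZMod k // i ≠ 0}) =>
    (if i.1 = j.1 then (1 : R) else 0) - if alphaRel k A i.1 j.1 then 1 else 0] at hdet
  have hleft : ∀ S : {i : ZMod k // i ≠ 0} → Finset (ZMod k),
      (if (∀ i, S i ≠ Finset.univ) ∧ AlphaTree S then 1 else 0) * ∏ i, ∏ l ∈ S i, x l =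
      (∏ i, w (S i)) * (Matrix.of fun i j : {i : ZMod k // i ≠ 0} =>
        (if i.1 = j.1 then (1 : R) else 0) - if alphaRel k (S i) i.1 j.1 then 1 else 0).det := by
    intro S
    rw [hwprod]
    by_cases hS : ∀ i, S i ≠ Finset.univ
    · rw [det_alpha_laplacian hS]
      by_cases ht : AlphaTree S <;> simp [hS, ht]
    · simp only [hS, false_and, if_false, zero_mul]
  have hright : ∀ S : {i : ZMod k // i ≠ 0} → Finset (ZMod k),
      (if (∀ i, S i ≠ Finset.univ) ∧ 0 ∉ S i₀ then 1 else 0) * ∏ i, ∏ l ∈ S i, x l =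
      ∏ i, if i = i₀ then (if (0 : ZMod k) ∉ S i then w (S i) else 0) else w (S i) := by
    intro S
    by_cases h0 : (0 : ZMod k) ∈ S i₀
    · exact Eq.trans (by simp [h0])
        (Finset.prod_eq_zero (Finset.mem_univ i₀) (by simp [h0])).symm
    · simp only [h0, not_false_eq_true, and_true]
      rw [← hwprod]
      refine Finset.prod_congr rfl fun i _ => ?_
      by_cases hi : i = i₀
      · subst hi; simp [h0]
      · simp [hi]
  rw [Finset.sum_congr rfl fun S _ => hleft S, hdet, Finset.sum_congr rfl fun S _ => hright S]
  have hexp := Finset.prod_univ_sum (fun _ : {i : ZMod k // i ≠ 0} =>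
    (Finset.univ : Finset (Finset (ZMod k)))) (fun i A =>
      if i = i₀ then (if (0 : ZMod k) ∉ A then w A else 0) else w A)
  rw [Fintype.piFinset_univ] at hexp
  rw [← hexp]
  refine Fintype.prod_equiv (Equiv.swap ⟨-1, hk⟩ i₀) _ _ fun i => ?_
  rw [hQ, hT]
  have hiff : Equiv.swap ⟨-1, hk⟩ i₀ i = i₀ ↔ i = ⟨-1, hk⟩ := by
    rw [Equiv.swap_apply_eq_iff, Equiv.swap_apply_right]
  by_cases hi : i = ⟨-1, hk⟩
  · simp only [hiff.2 hi, if_pos hi, if_true]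
  · simp only [mt hiff.1 hi, if_neg hi, if_false]

lemma card_alphaTree_eq (p : ZMod k → ℕ) (hk : (-1 : ZMod k) ≠ 0) (i₀ : {i : ZMod k // i ≠ 0}) :
    Nat.card {S : {i : ZMod k // i ≠ 0} → Finset (ZMod k) //
      (∀ j, Nat.card {i // j ∈ S i} = p j) ∧ (∀ i, S i ≠ Finset.univ) ∧ AlphaTree S} =
    Nat.card {S : {i : ZMod k // i ≠ 0} → Finset (ZMod k) //
      (∀ j, Nat.card {i // j ∈ S i} = p j) ∧ (∀ i, S i ≠ Finset.univ) ∧ 0 ∉ S i₀} := by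
  classical
  have hX : ∀ l : ZMod k, 1 + (MvPolynomial.X l : MvPolynomial (ZMod k) ℤ) ≠ 0 := fun l h => by
    have := congrArg MvPolynomial.constantCoeff h
    simp at this
  have h := congrArg (MvPolynomial.coeff (Finsupp.equivFunOnFinite.symm p))
    (sum_alphaTree_eq MvPolynomial.X hX hk i₀)
  rw [coeff_sum_tuples, coeff_sum_tuples] at h
  exact_mod_cast h

end Main

/-- The case `r = k-1`: for `S = (S_1,…,S_{k-1})` uniform on `ℳ_{p,k-1}` (here indexed
directly by the elements of `[k-1]`, i.e. the nonzero elements of `ZMod k`), the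
probability that the digraph `G_α(S)` with arcs `(i, α(i,S_i))`, `i ∈ [k-1]`, is a
tree equals `1 - p_k / (k-1)`. -/
theorem prob_tree_alpha_identity (k : ℕ) [NeZero k] (hk : 2 ≤ k) (p : ZMod k → ℕ)
    (hM : Nonempty {S : {i : ZMod k // i ≠ 0} → Finset (ZMod k) //
      (∀ j : ZMod k, Nat.card {i : {i : ZMod k // i ≠ 0} // j ∈ S i} = p j) ∧
      ∀ i, S i ≠ Finset.univ}) :
    (Nat.card {S : {S : {i : ZMod k // i ≠ 0} → Finset (ZMod k) //
          (∀ j : ZMod k, Nat.card {i : {i : ZMod k // i ≠ 0} // j ∈ S i} = p j) ∧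
          ∀ i, S i ≠ Finset.univ} //
        ∃ g : ZMod k → ZMod k, g 0 = 0 ∧
          (∀ i : {i : ZMod k // i ≠ 0}, alphaRel k (S.1 i) i.1 (g i.1)) ∧
          ∀ x : ZMod k, ∃ n : ℕ, g^[n] x = 0} : ℚ) /
      (Nat.card {S : {i : ZMod k // i ≠ 0} → Finset (ZMod k) //
          (∀ j : ZMod k, Nat.card {i : {i : ZMod k // i ≠ 0} // j ∈ S i} = p j) ∧
          ∀ i, S i ≠ Finset.univ} : ℚ) =
    1 - (p 0 : ℚ) / ((k - 1 : ℕ) : ℚ) := by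
  classical
  have hk0 : (-1 : ZMod k) ≠ 0 := by
    rw [← ZMod.val_ne_zero, ZMod.val_neg_one_eq]
    omega
  set M := {S : {i : ZMod k // i ≠ 0} → Finset (ZMod k) //
      (∀ j : ZMod k, Nat.card {i : {i : ZMod k // i ≠ 0} // j ∈ S i} = p j) ∧
      ∀ i, S i ≠ Finset.univ} with hMdef
  change (Nat.card {S : M // AlphaTree S.1} : ℚ) / (Nat.card M : ℚ) = _
  have hN : (Nat.card M : ℚ) ≠ 0 := by
    exact_mod_cast Nat.card_ne_zero.2 ⟨hM, inferInstance⟩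
  have hι : Fintype.card {i : ZMod k // i ≠ 0} = k - 1 := by
    rw [Fintype.card_subtype_compl, ZMod.card, Fintype.card_subtype_eq]
  have hk1 : ((k - 1 : ℕ) : ℚ) ≠ 0 := by
    exact_mod_cast (by omega : k - 1 ≠ 0)
  have hnest : ∀ Q : ({i : ZMod k // i ≠ 0} → Finset (ZMod k)) → Prop,
      Nat.card {S : M // Q S.1} = Nat.card {S : {i : ZMod k // i ≠ 0} → Finset (ZMod k) //
        (∀ j, Nat.card {i // j ∈ S i} = p j) ∧ (∀ i, S i ≠ Finset.univ) ∧ Q S} := fun Q =>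
    Nat.card_congr ((Equiv.subtypeSubtypeEquivSubtypeInter _ Q).trans
      (Equiv.subtypeEquivRight fun _ => and_assoc))
  have hcount : ∀ S : M, (Finset.univ.filter fun i => (0 : ZMod k) ∉ S.1 i).card + p 0 = k - 1 := by
    intro S
    rw [← S.2.1 0, ← hι, Nat.card_eq_fintype_card, Fintype.card_subtype, add_comm]
    exact Finset.card_filter_add_card_filter_not _
  have hdouble : (k - 1) * Nat.card {S : M // AlphaTree S.1} + Nat.card M * p 0 =
      Nat.card M * (k - 1) := by
    have h1 : ∑ i, Nat.card {S : M // (0 : ZMod k) ∉ S.1 i} =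
        (k - 1) * Nat.card {S : M // AlphaTree S.1} := by
      rw [Finset.sum_congr rfl fun i _ => ((hnest _).trans
        ((card_alphaTree_eq p hk0 i).symm.trans (hnest _).symm)), Finset.sum_const,
        Finset.card_univ, hι, smul_eq_mul]
    have h2 : ∑ i, Nat.card {S : M // (0 : ZMod k) ∉ S.1 i} =
        ∑ S : M, (Finset.univ.filter fun i => (0 : ZMod k) ∉ S.1 i).card := by
      simp only [Nat.card_eq_fintype_card, Fintype.card_subtype, Finset.card_filter]
      exact Finset.sum_comm
    have h3 := Finset.sum_congr rfl fun S (_ : S ∈ (Finset.univ : Finset M)) => hcount S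
    rw [Finset.sum_add_distrib, ← h2, h1, Finset.sum_const, Finset.sum_const, Finset.card_univ,
      smul_eq_mul, smul_eq_mul] at h3
    rwa [Nat.card_eq_fintype_card (α := M)]
  have hdouble' : ((k - 1 : ℕ) : ℚ) * Nat.card {S : M // AlphaTree S.1} + Nat.card M * p 0 =
      Nat.card M * ((k - 1 : ℕ) : ℚ) := by exact_mod_cast hdouble
  field_simp
  linear_combination hdouble'
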